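/- Let T and S be finite trees, each on at least two vertices, such that the eccentric graphs E(T) and E(S) are both acyclic. Then the eccentric graph E(T □ S) is acyclic, and moreover E(T □ S) has exactly 2 connected components. -/

import Mathlib

open SimpleGraph

/-- The eccentricity of a vertex `v`: the max distance from `v` to any vertex. -/
noncomputable def ecc {V : Type*} [Fintype V] (G : SimpleGraph V) (v : V) : ℕ :=
  Finset.univ.sup fun u => G.dist v u

/-- `u` is eccentric to `v` in `G` if `d(v,u) = e(v)`. -/
def IsEccentric {V : Type*} [Fintype V] (G : SimpleGraph V) (v u : V) : Prop :=
  G.dist v u = ecc G v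

/-- The eccentric graph of `G`: distinct `u, v` adjacent iff one is eccentric to the other. -/
noncomputable def eccGraph {V : Type*} [Fintype V] (G : SimpleGraph V) : SimpleGraph V :=
  SimpleGraph.fromRel fun u v => IsEccentric G u v

/-- The diameter of `G`: the maximum eccentricity. -/
noncomputable def gdiam {V : Type*} [Fintype V] (G : SimpleGraph V) : ℕ :=
  Finset.univ.sup fun v => ecc G v

section Tree

variable {V : Type*} {G : SimpleGraph V}

lemma SimpleGraph.IsTree.dist_eq_length (hG : G.IsTree) {u v : V} {p : G.Walk u v}
    (hp : p.IsPath) : G.dist u v = p.length := by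
  obtain ⟨q, hq, hlen⟩ := hG.connected.exists_path_of_dist u v
  have h : q = p := congrArg Subtype.val <|
    (hG.isAcyclic.subsingleton_path u v).elim ⟨q, hq⟩ ⟨p, hp⟩
  rw [← hlen, h]

/-- A vertex on a geodesic splits its length. -/
lemma SimpleGraph.Walk.dist_add_dist_of_mem_support (hG : G.Connected) {u v w : V}
    {p : G.Walk u v} (hp : p.length = G.dist u v) (hw : w ∈ p.support) :
    G.dist u w + G.dist w v = G.dist u v := by
  classical
  have h := congrArg Walk.length (p.take_spec hw)
  rw [Walk.length_append] at h
  have h₁ := dist_le (p.takeUntil w hw)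
  have h₂ := dist_le (p.dropUntil w hw)
  have h₃ := hG.dist_triangle (u := u) (v := w) (w := v)
  omega

/-- In a tree, distances between vertices on different sides of an edge add up. -/
lemma SimpleGraph.IsTree.dist_eq_of_adj (hG : G.IsTree) {x x' y z : V} (hadj : G.Adj x' x)
    (hy : G.dist x y = G.dist x' y + 1) (hz : G.dist x' z = G.dist x z + 1) :
    G.dist y z = G.dist x' y + 1 + G.dist x z := by
  obtain ⟨p, hp, hpl⟩ := hG.connected.exists_path_of_dist y x'
  obtain ⟨q, hq, hql⟩ := hG.connected.exists_path_of_dist x z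
  have hpath : (p.append (.cons hadj q)).IsPath := by
    rw [Walk.isPath_def, Walk.support_append, Walk.support_cons, List.tail_cons,
      List.nodup_append]
    refine ⟨hp.support_nodup, hq.support_nodup, ?_⟩
    rintro t htp _ htq rfl
    have h₁ := Walk.dist_add_dist_of_mem_support hG.connected hpl htp
    have h₂ := Walk.dist_add_dist_of_mem_support hG.connected hql htq
    have h₃ := hG.connected.dist_triangle (u := x) (v := t) (w := y)
    have h₄ := hG.connected.dist_triangle (u := x') (v := t) (w := z)
    rw [G.dist_comm (u := y) (v := x'), G.dist_comm (u := t) (v := x')] at h₁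
    rw [G.dist_comm (u := t) (v := y)] at h₃
    omega
  rw [hG.dist_eq_length hpath, Walk.length_append, Walk.length_cons, hpl, hql,
    G.dist_comm (u := y)]
  omega

lemma SimpleGraph.Connected.exists_adj_dist_eq (hG : G.Connected) {x y : V} (hxy : x ≠ y) :
    ∃ x', G.Adj x x' ∧ G.dist x y = G.dist x' y + 1 := by
  obtain ⟨p, hp⟩ := hG.exists_walk_length_eq_dist x y
  cases p with
  | nil => exact absurd rfl hxy
  | @cons _ x' _ h q =>
    refine ⟨x', h, ?_⟩
    have h₁ := dist_le q
    have h₂ := hG.dist_triangle (u := x) (v := x') (w := y)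
    rw [dist_eq_one_iff_adj.mpr h] at h₂
    rw [Walk.length_cons] at hp
    omega

/-- The four-point condition for trees. -/
lemma SimpleGraph.IsTree.four_point (hG : G.IsTree) (x y z w : V) :
    G.dist x y + G.dist z w ≤
      max (G.dist x z + G.dist y w) (G.dist x w + G.dist y z) := by
  induction hn : G.dist x y generalizing x with
  | zero =>
    obtain rfl := hG.connected.dist_eq_zero_iff.mp hn
    have h := hG.connected.dist_triangle (u := z) (v := x) (w := w)
    rw [G.dist_comm (u := z) (v := x)] at h
    omega
  | succ n ih =>
    have hxy : x ≠ y := by rintro rfl; simp at hn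
    obtain ⟨x', hadj, hd⟩ := hG.connected.exists_adj_dist_eq hxy
    have hih := ih x' (by omega)
    have hz := hG.dist_eq_dist_add_one_of_adj z hadj
    have hw := hG.dist_eq_dist_add_one_of_adj w hadj
    rw [G.dist_comm (u := z) (v := x), G.dist_comm (u := z) (v := x')] at hz
    rw [G.dist_comm (u := w) (v := x), G.dist_comm (u := w) (v := x')] at hw
    rcases hz with hz | hz <;> rcases hw with hw | hw
    · omega
    · have h₁ := hG.dist_eq_of_adj hadj.symm hd hw
      have h₂ := hG.dist_eq_of_adj hadj.symm hz hw
      omega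
    · have h₁ := hG.dist_eq_of_adj hadj.symm hd hz
      have h₂ := hG.dist_eq_of_adj hadj.symm hw hz
      rw [G.dist_comm (u := w) (v := z)] at h₂
      omega
    · have h₁ := hG.dist_eq_of_adj hadj.symm hd hz
      have h₂ := hG.dist_eq_of_adj hadj.symm hd hw
      have h₃ := hG.connected.dist_triangle (u := z) (v := x) (w := w)
      rw [G.dist_comm (u := z) (v := x)] at h₃
      omega

lemma SimpleGraph.IsAcyclic.not_adj_of_adj_of_adj (hG : G.IsAcyclic) {x y z : V}
    (hxy : G.Adj x y) (hyz : G.Adj y z) : ¬ G.Adj x z := by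
  intro hxz
  have h := (hG.subsingleton_path x z).elim ⟨.cons hxz .nil, by simp [hxz.ne]⟩
    ⟨.cons hxy (.cons hyz .nil), by simp [hxy.ne, hyz.ne, hxz.ne]⟩
  simpa using congrArg (fun p => p.1.length) h

lemma SimpleGraph.IsAcyclic.eq_of_common_neighbors (hG : G.IsAcyclic) {x y z w : V}
    (hxz : x ≠ z) (hxy : G.Adj x y) (hyz : G.Adj y z) (hxw : G.Adj x w) (hwz : G.Adj w z) :
    y = w := by
  have h := (hG.subsingleton_path x z).elim
    ⟨.cons hxy (.cons hyz .nil), by simp [hxy.ne, hyz.ne, hxz]⟩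
    ⟨.cons hxw (.cons hwz .nil), by simp [hxw.ne, hwz.ne, hxz]⟩
  simpa using congrArg (fun p => p.1.snd) h

end Tree

section Diametral

variable {V : Type*} {G : SimpleGraph V}

/-- `a` and `b` are at maximum distance in `G`. -/
def IsDiametral (G : SimpleGraph V) (a b : V) : Prop :=
  ∀ x y, G.dist x y ≤ G.dist a b

lemma IsDiametral.symm {a b : V} (h : IsDiametral G a b) : IsDiametral G b a := by
  intro x y
  rw [G.dist_comm (u := b)]
  exact h x y

lemma exists_isDiametral [Finite V] [Nonempty V] (G : SimpleGraph V) :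
    ∃ a b, IsDiametral G a b := by
  obtain ⟨⟨a, b⟩, h⟩ := Finite.exists_max fun p : V × V => G.dist p.1 p.2
  exact ⟨a, b, fun x y => h (x, y)⟩

lemma IsDiametral.ne [Nontrivial V] (hG : G.Connected) {a b : V} (h : IsDiametral G a b) :
    a ≠ b := by
  rintro rfl
  obtain ⟨x, y, hxy⟩ := exists_pair_ne V
  have h₁ := h x y
  have h₂ := hG.pos_dist_of_ne hxy
  rw [dist_self] at h₁
  omega

/-- In a tree, the ends of a diameter determine all eccentricities. -/
lemma IsDiametral.dist_le_max (hG : G.IsTree) {a b : V} (h : IsDiametral G a b) (v u : V) :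
    G.dist v u ≤ max (G.dist v a) (G.dist v b) := by
  have h₁ := hG.four_point v u a b
  have h₂ := h u b
  have h₃ := h u a
  omega

end Diametral

section Eccentric

variable {V : Type*} [Fintype V] {G : SimpleGraph V}

lemma dist_le_ecc (G : SimpleGraph V) (v u : V) : G.dist v u ≤ ecc G v :=
  Finset.le_sup (f := fun u => G.dist v u) (Finset.mem_univ u)

lemma isEccentric_iff {v u : V} : IsEccentric G v u ↔ ∀ w, G.dist v w ≤ G.dist v u := by
  refine ⟨fun h w => (dist_le_ecc G v w).trans_eq h.symm, fun h => ?_⟩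
  exact (dist_le_ecc G v u).antisymm (Finset.sup_le fun w _ => h w)

lemma exists_isEccentric (G : SimpleGraph V) (v : V) : ∃ u, IsEccentric G v u := by
  have : Nonempty V := ⟨v⟩
  obtain ⟨u, hu⟩ := Finite.exists_max (G.dist v)
  exact ⟨u, isEccentric_iff.mpr hu⟩

lemma eccGraph_adj {u v : V} :
    (eccGraph G).Adj u v ↔ u ≠ v ∧ (IsEccentric G u v ∨ IsEccentric G v u) := by
  simp [eccGraph]

lemma IsDiametral.isEccentric {a b : V} (h : IsDiametral G a b) : IsEccentric G a b :=
  isEccentric_iff.mpr fun w => h a w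

lemma IsEccentric.ne [Nontrivial V] (hG : G.Connected) {v u : V} (h : IsEccentric G v u) :
    v ≠ u := by
  rintro rfl
  obtain ⟨w, hw⟩ := exists_ne v
  have h₁ := isEccentric_iff.mp h w
  have h₂ := hG.pos_dist_of_ne hw.symm
  rw [dist_self] at h₁
  omega

lemma IsEccentric.adj [Nontrivial V] (hG : G.Connected) {v u : V} (h : IsEccentric G v u) :
    (eccGraph G).Adj v u :=
  eccGraph_adj.mpr ⟨h.ne hG, .inl h⟩

lemma IsDiametral.dist_ne [Nontrivial V] (hG : G.IsTree) (hE : (eccGraph G).IsAcyclic) {a b : V}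
    (h : IsDiametral G a b) (v : V) : G.dist v a ≠ G.dist v b := by
  intro heq
  have hmax := h.dist_le_max hG v
  have ha : IsEccentric G v a := isEccentric_iff.mpr fun w => by grind
  have hb : IsEccentric G v b := isEccentric_iff.mpr fun w => by grind
  exact hE.not_adj_of_adj_of_adj (ha.adj hG.connected) (h.isEccentric.adj hG.connected)
    (hb.adj hG.connected)

lemma IsDiametral.left_unique [Nontrivial V] (hG : G.IsTree) (hE : (eccGraph G).IsAcyclic)
    {a b u : V} (h : IsDiametral G a b) (hu : IsDiametral G u b) : u = a := by
  have hc := hG.connected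
  by_contra hne
  have hab := hc.pos_dist_of_ne (h.ne hc)
  have hD : G.dist u b = G.dist a b := (h u b).antisymm (hu a b)
  obtain ⟨w, hbw, hw⟩ := hc.exists_adj_dist_eq (h.ne hc).symm
  have hwb : G.dist w b = 1 := dist_eq_one_iff_adj.mpr hbw.symm
  have hua := hc.pos_dist_of_ne hne
  have h₁ := h.dist_ne hG hE u
  have h₂ := h u a
  have h₃ := h.dist_ne hG hE w
  have hcomm := G.dist_comm (u := a) (v := b)
  have htri := hc.dist_triangle (u := u) (v := w) (w := b)
  rw [G.dist_comm (u := u) (v := w)] at htri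
  have hmax := h.dist_le_max hG w
  have hwa : IsEccentric G w a := isEccentric_iff.mpr fun x => by grind
  have hwu : IsEccentric G w u := isEccentric_iff.mpr fun x => by grind
  exact hne (hE.eq_of_common_neighbors hbw.ne.symm (hwu.adj hc) (hu.isEccentric.adj hc)
    (hwa.adj hc) (h.isEccentric.adj hc))

lemma IsDiametral.eq_of_isEccentric [Nontrivial V] (hG : G.IsTree) (hE : (eccGraph G).IsAcyclic)
    {a b v u : V} (h : IsDiametral G a b) (hu : IsEccentric G v u) : u = a ∨ u = b := by
  rw [isEccentric_iff] at hu
  have h₁ := hG.four_point v u a b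
  have h₂ := h u a
  have h₃ := h u b
  have h₄ := hu a
  have h₅ := hu b
  rcases (h.dist_ne hG hE v).lt_or_gt with hlt | hlt
  · right
    exact h.symm.left_unique hG hE fun x y => (h x y).trans (by omega)
  · left
    exact h.left_unique hG hE fun x y => (h x y).trans (by omega)

/-- `f` sends each vertex to its unique eccentric vertex, which is one of `a` and `b`. -/
structure IsEccentricMap (G : SimpleGraph V) (f : V → V) (a b : V) : Prop where
  isEccentric_iff : ∀ v u, IsEccentric G v u ↔ u = f v
  eq_or_eq : ∀ v, f v = a ∨ f v = b
  map_left : f a = b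
  map_right : f b = a
  ne : a ≠ b

lemma SimpleGraph.IsTree.exists_isEccentricMap [Nontrivial V] (hG : G.IsTree)
    (hE : (eccGraph G).IsAcyclic) : ∃ f a b, IsEccentricMap G f a b := by
  obtain ⟨a, b, h⟩ := exists_isDiametral G
  choose f hf using exists_isEccentric G
  have huniq : ∀ v u, IsEccentric G v u → u = f v := by
    intro v u hu
    have heq : G.dist v u = G.dist v (f v) := Eq.trans hu (hf v).symm
    have hne := h.dist_ne hG hE v
    rcases h.eq_of_isEccentric hG hE hu with rfl | rfl <;>
      rcases h.eq_of_isEccentric hG hE (hf v) with hfv | hfv <;> grind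
  refine ⟨f, a, b, fun v u => ⟨huniq v u, ?_⟩, fun v => h.eq_of_isEccentric hG hE (hf v),
    (huniq _ _ h.isEccentric).symm, (huniq _ _ h.symm.isEccentric).symm, h.ne hG.connected⟩
  rintro rfl
  exact hf v

end Eccentric

section BoxProd

variable {α β : Type*} {T : SimpleGraph α} {S : SimpleGraph β}

lemma SimpleGraph.Connected.dist_boxProd (hT : T.Connected) (hS : S.Connected) (x y : α × β) :
    (T.boxProd S).dist x y = T.dist x.1 y.1 + S.dist x.2 y.2 := by
  have h := edist_boxProd (G := T) (H := S) x y
  rw [← ((hT.boxProd hS) x y).coe_dist_eq_edist, ← (hT x.1 y.1).coe_dist_eq_edist,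
    ← (hS x.2 y.2).coe_dist_eq_edist] at h
  exact_mod_cast h

lemma isEccentric_boxProd [Fintype α] [Fintype β] (hT : T.Connected)
    (hS : S.Connected) {x y : α × β} :
    IsEccentric (T.boxProd S) x y ↔ IsEccentric T x.1 y.1 ∧ IsEccentric S x.2 y.2 := by
  simp only [isEccentric_iff, hT.dist_boxProd hS]
  refine ⟨fun h => ⟨fun w => ?_, fun w => ?_⟩, fun h w => add_le_add (h.1 _) (h.2 _)⟩
  · simpa using h (w, y.2)
  · simpa using h (y.1, w)

end BoxProd

section Functional

variable {V : Type*} {G : SimpleGraph V}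

lemma SimpleGraph.Reachable.induction_on_adj {P : V → Prop}
    (hP : ∀ u v, G.Adj u v → P u → P v) {u v : V} (h : G.Reachable u v) (hu : P u) : P v := by
  obtain ⟨p⟩ := h
  induction p with
  | nil => exact hu
  | cons hadj _ ih => exact ih (hP _ _ hadj hu)

/-- The graph joining each `x` to `F x` is acyclic if the image of `F` consists of points
of period two. -/
lemma isAcyclic_of_adj_iff {F : V → V} (hadj : ∀ x y, G.Adj x y ↔ y = F x ∨ x = F y)
    (hF : ∀ x, F (F (F x)) = F x) : G.IsAcyclic := by
  rw [isAcyclic_iff_forall_adj_isBridge]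
  have key : ∀ x, G.IsBridge s(x, F x) := by
    intro x
    rw [isBridge_iff]
    intro hr
    have hne : F x ≠ x := ((hadj x (F x)).mpr (.inl rfl)).ne.symm
    have h := hr.induction_on_adj (P := fun y => y = x ∨ (F y = x ∧ y ≠ F x)) ?_ (.inl rfl)
    · grind
    · intro u v huv hu
      simp only [deleteEdges_adj, hadj, Set.mem_singleton_iff, Sym2.eq_iff] at huv
      grind
  intro x y hxy
  rcases (hadj x y).mp hxy with rfl | rfl
  · exact key x
  · rw [Sym2.eq_swap]
    exact key y

end Functional

/-- If `T` and `S` are trees whose eccentric graphs are acyclic, then the eccentric graph of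
`T □ S` is acyclic with exactly 2 connected components. -/
theorem stmt_9 {α β : Type*} [Fintype α] [Fintype β]
    (T : SimpleGraph α) (S : SimpleGraph β) (hT : T.IsTree) (hS : S.IsTree)
    (hcardT : 2 ≤ Fintype.card α) (hcardS : 2 ≤ Fintype.card β)
    (hTacyc : (eccGraph T).IsAcyclic) (hSacyc : (eccGraph S).IsAcyclic) :
    (eccGraph (T.boxProd S)).IsAcyclic ∧
      Nat.card (eccGraph (T.boxProd S)).ConnectedComponent = 2 := by
  have : Nontrivial α := Fintype.one_lt_card_iff_nontrivial.mp hcardT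
  have : Nontrivial β := Fintype.one_lt_card_iff_nontrivial.mp hcardS
  obtain ⟨f, a, b, hf⟩ := hT.exists_isEccentricMap hTacyc
  obtain ⟨g, c, d, hg⟩ := hS.exists_isEccentricMap hSacyc
  have hfne : ∀ x, f x ≠ x := fun x h => by grind [hf.eq_or_eq x, hf.map_left, hf.map_right, hf.ne]
  have hadj : ∀ x y : α × β, (eccGraph (T.boxProd S)).Adj x y ↔
      y = (f x.1, g x.2) ∨ x = (f y.1, g y.2) := by
    intro x y
    rw [eccGraph_adj, isEccentric_boxProd hT.connected hS.connected,
      isEccentric_boxProd hT.connected hS.connected, hf.isEccentric_iff, hf.isEccentric_iff,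
      hg.isEccentric_iff, hg.isEccentric_iff, Prod.ext_iff, Prod.ext_iff]
    refine and_iff_right_of_imp ?_
    rintro (h | h) rfl
    · exact hfne x.1 h.1.symm
    · exact hfne x.1 h.1.symm
  refine ⟨isAcyclic_of_adj_iff (F := fun x => (f x.1, g x.2)) hadj fun x => ?_, ?_⟩
  · grind [hf.eq_or_eq x.1, hf.map_left, hf.map_right, hg.eq_or_eq x.2, hg.map_left, hg.map_right]
  rw [Nat.card_eq_two_iff]
  refine ⟨connectedComponentMk _ (a, c), connectedComponentMk _ (a, d), fun h => ?_, ?_⟩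
  · have h' := (ConnectedComponent.exact h).induction_on_adj
      (P := fun x : α × β => f x.1 = a ↔ g x.2 = c) ?_
      (by simp [hf.map_left, hg.map_left, hf.ne.symm, hg.ne.symm])
    · simp [hf.map_left, hg.map_right, hf.ne.symm] at h'
    · intro x y hxy hx
      grind [hf.eq_or_eq x.1, hf.eq_or_eq y.1, hf.map_left, hf.map_right, hf.ne,
        hg.eq_or_eq x.2, hg.eq_or_eq y.2, hg.map_left, hg.map_right, hg.ne]
  · refine Set.eq_univ_of_forall fun C => ?_
    induction C using ConnectedComponent.ind with
    | _ x =>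
    have step : ∀ x : α × β, connectedComponentMk (eccGraph (T.boxProd S)) x =
        connectedComponentMk _ (f x.1, g x.2) := fun x =>
      ConnectedComponent.sound ((hadj _ _).mpr (.inl rfl)).reachable
    have hac := step (a, c)
    have had := step (a, d)
    simp only [hf.map_left, hg.map_left, hg.map_right] at hac had
    rw [step x]
    rcases hf.eq_or_eq x.1 with h₁ | h₁ <;> rcases hg.eq_or_eq x.2 with h₂ | h₂ <;>
      simp [h₁, h₂, hac, had]
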